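/- Let X be a topological space, and for p ≥ 0 define h(p) = inf{f(x) | x ∈ A, φ(x) ≤ p}. Then the penalty function F_λ is (globally) exact if and only if F_μ is bounded below on A for some μ > 0 and h is calm from below at the origin, i.e. liminf_{p → 0+} (h(p) − h(0))/p > −∞. -/

import Mathlib

open Filter Topology Set

/-- The linear penalty function `F_λ = f + λ φ`. -/
noncomputable def penaltyFun {X : Type*} (f : X → EReal) (φ : X → ℝ) (lam : ℝ) : X → EReal :=
  fun x => f x + ((lam * φ x : ℝ) : EReal)

/-- The penalty function `F_λ` is globally exact. -/
def GloballyExact {X : Type*} (f : X → EReal) (φ : X → ℝ) (A M : Set X) : Prop :=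
  ∃ lam0 : ℝ, 0 ≤ lam0 ∧ ∀ lam : ℝ, lam0 < lam →
    {x | x ∈ A ∧ ∀ y ∈ A, penaltyFun f φ lam x ≤ penaltyFun f φ lam y} =
      {x | x ∈ M ∩ A ∧ ∀ y ∈ M ∩ A, f x ≤ f y}

/-- The optimal value function `h(p) = inf { f(x) | x ∈ A, φ(x) ≤ p }` of the perturbed
problem. -/
noncomputable def optValFun {X : Type*} (f : X → EReal) (φ : X → ℝ) (A : Set X)
    (p : ℝ) : EReal :=
  ⨅ x ∈ {x | x ∈ A ∧ φ x ≤ p}, f x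

/-- Adding a penalty and moving it to the other side, for an objective that avoids `⊥`. -/
theorem coe_le_penaltyFun_iff {X : Type*} {f : X → EReal} (hfbot : ∀ x, f x ≠ ⊥)
    (φ : X → ℝ) (lam c : ℝ) (x : X) :
    (c : EReal) ≤ penaltyFun f φ lam x ↔ ((c - lam * φ x : ℝ) : EReal) ≤ f x := by
  have hx := hfbot x
  unfold penaltyFun
  generalize f x = a at hx ⊢
  induction a with
  | bot => exact absurd rfl hx
  | top => rw [EReal.top_add_coe]; simp
  | coe a =>
    norm_cast
    rw [sub_le_iff_le_add]

theorem penaltyFun_of_eq_zero {X : Type*} (f : X → EReal) {φ : X → ℝ} (lam : ℝ) {x : X}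
    (hx : φ x = 0) : penaltyFun f φ lam x = f x := by
  simp [penaltyFun, hx]

/-- Exactness amounts to the optimal value being a lower bound of some penalty function. -/
theorem globallyExact_iff_exists_le_penaltyFun {X : Type*} {f : X → EReal} {φ : X → ℝ}
    {A : Set X} (hfbot : ∀ x, f x ≠ ⊥) (hφnn : ∀ x, 0 ≤ φ x) {z : X} {r : ℝ}
    (hzA : z ∈ A) (hzφ : φ z = 0) (hzr : f z = r) (hmin : ∀ y ∈ A, φ y = 0 → f z ≤ f y) :
    GloballyExact f φ A {x | φ x = 0} ↔
      ∃ lam : ℝ, 0 ≤ lam ∧ ∀ x ∈ A, (r : EReal) ≤ penaltyFun f φ lam x := by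
  constructor
  · rintro ⟨lam0, h0, h⟩
    refine ⟨lam0 + 1, by positivity, fun x hx => ?_⟩
    have hz : z ∈ {x | x ∈ {x | φ x = 0} ∩ A ∧ ∀ y ∈ {x | φ x = 0} ∩ A, f x ≤ f y} :=
      ⟨⟨hzφ, hzA⟩, fun y hy => hmin y hy.2 hy.1⟩
    rw [← h (lam0 + 1) (by linarith)] at hz
    simpa only [penaltyFun_of_eq_zero f _ hzφ, hzr] using hz.2 x hx
  · rintro ⟨lam0, h0, h⟩
    refine ⟨lam0, h0, fun lam hlam => Set.ext fun x => ⟨?_, ?_⟩⟩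
    · rintro ⟨hxA, hx⟩
      have hxr := hx z hzA
      rw [penaltyFun_of_eq_zero f _ hzφ, hzr] at hxr
      have hxφ : φ x = 0 := by
        have hlow := (coe_le_penaltyFun_iff hfbot φ lam0 r x).1 (h x hxA)
        have : ((r - lam0 * φ x + lam * φ x : ℝ) : EReal) ≤ r := by
          rw [EReal.coe_add]
          exact (add_le_add_left hlow _).trans hxr
        have := EReal.coe_le_coe_iff.1 this
        nlinarith [hφnn x]
      rw [penaltyFun_of_eq_zero f _ hxφ, ← hzr] at hxr
      exact ⟨⟨hxφ, hxA⟩, fun y hy => hxr.trans (hmin y hy.2 hy.1)⟩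
    · rintro ⟨⟨hxφ, hxA⟩, hx⟩
      refine ⟨hxA, fun y hy => ?_⟩
      rw [penaltyFun_of_eq_zero f _ hxφ]
      refine (hx z ⟨hzφ, hzA⟩).trans ?_
      rw [hzr, coe_le_penaltyFun_iff hfbot]
      refine le_trans ?_ ((coe_le_penaltyFun_iff hfbot φ lam0 r y).1 (h y hy))
      exact EReal.coe_le_coe_iff.2 (by nlinarith [hφnn y])

theorem EReal.coe_le_sub_coe_div_coe_iff {a : EReal} {K r p : ℝ} (hp : 0 < p) :
    (K : EReal) ≤ (a - r) / (p : EReal) ↔ ((r + K * p : ℝ) : EReal) ≤ a := by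
  rw [EReal.le_div_iff_mul_le (by exact_mod_cast hp) (EReal.coe_ne_top p)]
  induction a with
  | bot => simp [← EReal.coe_mul]
  | top => simp
  | coe a =>
    norm_cast
    rw [le_sub_iff_add_le']

/-- Theorem: the penalty function `F_λ` is globally exact iff `F_μ` is bounded below on
`A` for some `μ > 0` and the optimal value function `h` is calm from below at the origin,
i.e. `liminf_{p → 0+} (h(p) - h(0))/p > -∞`. -/
theorem globallyExact_iff_optValFun_calm {X : Type*} [TopologicalSpace X]
    (f : X → EReal) (φ : X → ℝ) (A M : Set X)
    (hAne : A.Nonempty) (hMne : M.Nonempty)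
    (hfbot : ∀ x, f x ≠ ⊥) (hφnn : ∀ x, 0 ≤ φ x) (hMdef : M = {x | φ x = 0})
    (hattain : ∃ z ∈ M ∩ A, (∀ y ∈ M ∩ A, f z ≤ f y) ∧ f z ≠ ⊤) :
    GloballyExact f φ A M ↔
      ((∃ μ : ℝ, 0 < μ ∧ ∃ c : ℝ, ∀ x ∈ A, (c : EReal) ≤ penaltyFun f φ μ x) ∧
        ⊥ < Filter.liminf
          (fun p => (optValFun f φ A p - optValFun f φ A 0) / ((p : ℝ) : EReal))
          (𝓝[Set.Ioi (0:ℝ)] 0)) := by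
  subst hMdef
  obtain ⟨z, ⟨hzφ, hzA⟩, hmin, hztop⟩ := hattain
  obtain ⟨r, hzr⟩ : ∃ r : ℝ, f z = r := ⟨_, (EReal.coe_toReal hztop (hfbot z)).symm⟩
  have hopt : optValFun f φ A 0 = r := by
    refine le_antisymm ((iInf₂_le z ⟨hzA, hzφ.le⟩).trans_eq hzr) (le_iInf₂ fun x hx => ?_)
    exact hzr ▸ hmin x ⟨le_antisymm hx.2 (hφnn x), hx.1⟩
  rw [globallyExact_iff_exists_le_penaltyFun hfbot hφnn hzA hzφ hzr
    fun y hyA hyφ => hmin y ⟨hyφ, hyA⟩, hopt]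
  constructor
  · rintro ⟨lam, hlam, h⟩
    have hlow x (hx : x ∈ A) := (coe_le_penaltyFun_iff hfbot φ lam r x).1 (h x hx)
    refine ⟨⟨lam + 1, by positivity, r, fun x hx => ?_⟩, ?_⟩
    · rw [coe_le_penaltyFun_iff hfbot]
      exact le_trans (EReal.coe_le_coe_iff.2 (by nlinarith [hφnn x])) (hlow x hx)
    · refine (EReal.bot_lt_coe (-lam)).trans_le (le_liminf_of_le (by isBoundedDefault) ?_)
      filter_upwards [self_mem_nhdsWithin] with p hp
      rw [EReal.coe_le_sub_coe_div_coe_iff hp]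
      refine le_iInf₂ fun x hx => le_trans (EReal.coe_le_coe_iff.2 ?_) (hlow x hx.1)
      nlinarith [hx.2]
  · rintro ⟨⟨μ, hμ, c, hc⟩, hcalm⟩
    obtain ⟨K, -, hK⟩ := EReal.lt_iff_exists_real_btwn.1 hcalm
    obtain ⟨δ, hδ, hδK⟩ :=
      mem_nhdsGT_iff_exists_Ioo_subset.1 (eventually_lt_of_lt_liminf hK)
    have hδ : 0 < δ := hδ
    refine ⟨|K| + μ + |r - c| / δ, by positivity, fun x hx => ?_⟩
    rw [coe_le_penaltyFun_iff hfbot]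
    have hq : 0 ≤ |r - c| / δ := by positivity
    rcases (hφnn x).eq_or_lt' with h0 | hpos
    · simpa [h0, hzr] using hmin x ⟨h0, hx⟩
    rcases lt_or_ge (φ x) δ with hlt | hge
    · have hval := (EReal.coe_le_sub_coe_div_coe_iff hpos).1 (le_of_lt (hδK ⟨hpos, hlt⟩))
      refine le_trans (EReal.coe_le_coe_iff.2 ?_) (hval.trans (iInf₂_le x ⟨hx, le_rfl⟩))
      nlinarith [neg_abs_le K, mul_nonneg hq hpos.le, mul_pos hμ hpos]
    · refine le_trans (EReal.coe_le_coe_iff.2 ?_)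
        ((coe_le_penaltyFun_iff hfbot φ μ c x).1 (hc x hx))
      have hgap : |r - c| ≤ |r - c| / δ * φ x :=
        (div_mul_cancel₀ _ hδ.ne').symm.le.trans (mul_le_mul_of_nonneg_left hge hq)
      nlinarith [le_abs_self (r - c), mul_nonneg (abs_nonneg K) hpos.le]
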